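/- The real number ζ(3) is irrational. -/

import Mathlib

noncomputable def zeta3 : ℝ := ∑' n : ℕ, 1 / ((n : ℝ) + 1) ^ 3

namespace Apery

/-- The basic product of binomial coefficients. -/
noncomputable def t (n k : ℕ) : ℝ := (n.choose k : ℝ) * ((n + k).choose k : ℝ)

lemma t_zero_right (n : ℕ) : t n 0 = 1 := by simp [t]

lemma t_eq_zero {n k : ℕ} (h : n < k) : t n k = 0 := by
  simp [t, Nat.choose_eq_zero_of_lt h]

lemma t_pos {n k : ℕ} (h : k ≤ n) : 0 < t n k := by
  have h1 : 0 < n.choose k := Nat.choose_pos h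
  have h2 : 0 < (n + k).choose k := Nat.choose_pos (by omega)
  unfold t
  positivity

lemma t_rel1 {n k : ℕ} (h : k ≤ n + 1) :
    t (n + 1) k * ((n : ℝ) + 1 - k) = t n k * ((n : ℝ) + 1 + k) := by
  have h1 := Nat.choose_mul_succ_eq n k
  have h2 := Nat.choose_mul_succ_eq (n + k) k
  rw [show n + k + 1 - k = n + 1 by omega] at h2
  have h1' : (n.choose k : ℝ) * (n + 1) = ((n + 1).choose k : ℝ) * ((n : ℝ) + 1 - k) := by
    have := congrArg (Nat.cast : ℕ → ℝ) h1
    push_cast [Nat.cast_sub h] at this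
    exact this
  have h2' : ((n + k).choose k : ℝ) * (n + k + 1) = ((n + 1 + k).choose k : ℝ) * (n + 1) := by
    rw [show n + 1 + k = n + k + 1 by omega]
    exact_mod_cast h2
  have hn : (n : ℝ) + 1 ≠ 0 := by positivity
  unfold t
  apply mul_right_cancel₀ hn
  linear_combination (-((n + 1 + k).choose k : ℝ) * (n + 1)) * h1' -
    ((n.choose k : ℝ) * (n + 1)) * h2'

lemma t_rel2 {n k : ℕ} (h : k ≤ n) :
    t n (k + 1) * ((k : ℝ) + 1) ^ 2 = t n k * ((n : ℝ) - k) * (n + k + 1) := by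
  have h1 := Nat.choose_succ_right_eq n k
  have h2 := Nat.add_one_mul_choose_eq (n + k) k
  have h1' : (n.choose (k + 1) : ℝ) * (k + 1) = (n.choose k : ℝ) * ((n : ℝ) - k) := by
    have := congrArg (Nat.cast : ℕ → ℝ) h1
    push_cast [Nat.cast_sub h] at this
    exact this
  have h2' : ((n : ℝ) + k + 1) * ((n + k).choose k : ℝ) =
      ((n + (k + 1)).choose (k + 1) : ℝ) * (k + 1) := by
    exact_mod_cast h2
  unfold t
  linear_combination (((n + (k + 1)).choose (k + 1) : ℝ) * (k + 1)) * h1' -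
    ((n.choose k : ℝ) * ((n : ℝ) - k)) * h2'

lemma t_rel3 (n k : ℕ) :
    t (n + 1) (k + 1) * ((k : ℝ) + 1) ^ 2 = t n k * ((n : ℝ) + k + 1) * (n + k + 2) := by
  have h1 := Nat.add_one_mul_choose_eq n k
  have h2 := Nat.add_one_mul_choose_eq (n + k + 1) k
  have h3 := Nat.choose_mul_succ_eq (n + k) k
  rw [show n + k + 1 - k = n + 1 by omega] at h3
  have h1' : ((n : ℝ) + 1) * (n.choose k : ℝ) = ((n + 1).choose (k + 1) : ℝ) * (k + 1) := by
    exact_mod_cast h1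
  have h2' : ((n : ℝ) + k + 2) * ((n + k + 1).choose k : ℝ) =
      ((n + 1 + (k + 1)).choose (k + 1) : ℝ) * (k + 1) := by
    rw [show n + 1 + (k + 1) = n + k + 1 + 1 by omega]
    have := congrArg (Nat.cast : ℕ → ℝ) h2
    push_cast at this
    linear_combination this
  have h3' : ((n + k).choose k : ℝ) * (n + k + 1) = ((n + k + 1).choose k : ℝ) * (n + 1) := by
    exact_mod_cast h3
  unfold t
  linear_combination (-((n + 1 + (k + 1)).choose (k + 1) : ℝ) * (k + 1)) * h1' -
    (((n : ℝ) + 1) * (n.choose k : ℝ)) * h2' - ((n.choose k : ℝ) * (n + k + 2)) * h3'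

lemma t_param {n k : ℕ} (h : k ≤ n + 1) : ∃ g : ℝ, 0 < g ∧ t (n + 1) k = g * ((k : ℝ) + 1) ^ 2 ∧
    t (n + 1) (k + 1) = g * ((n : ℝ) + 1 - k) * (n + k + 2) ∧
    t (n + 2) (k + 1) = g * ((n : ℝ) + k + 2) * (n + k + 3) ∧
    t n (k + 1) = g * ((n : ℝ) + 1 - k) * (n - k) := by
  have hk : ((k : ℝ) + 1) ≠ 0 := by positivity
  have e1 := t_rel2 h
  have e2 := t_rel3 (n + 1) k
  push_cast at e1 e2
  have e3 : t (n + 1) (k + 1) = t (n + 1) k / ((k : ℝ) + 1) ^ 2 * ((n : ℝ) + 1 - k) * (n + k + 2) := by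
    field_simp
    linear_combination e1
  refine ⟨t (n + 1) k / ((k : ℝ) + 1) ^ 2, ?_, ?_, e3, ?_, ?_⟩
  · have := t_pos h
    positivity
  · field_simp
  · field_simp
    linear_combination e2
  · rcases Nat.lt_or_ge n k with h' | h'
    · obtain rfl : k = n + 1 := by omega
      rw [t_eq_zero (by omega)]
      push_cast
      ring
    · have e4 := @t_rel1 n (k + 1) (by omega)
      push_cast at e4
      have h5 : ((n : ℝ) + k + 2) ≠ 0 := by positivity
      apply mul_right_cancel₀ h5
      rw [e3] at e4
      linear_combination -e4

/-- The coefficient polynomial of Apéry's recurrence, centered at `n + 1`. -/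
noncomputable def P (n : ℕ) : ℝ :=
  34 * ((n : ℝ) + 1) ^ 3 + 51 * ((n : ℝ) + 1) ^ 2 + 27 * ((n : ℝ) + 1) + 5

/-- Zeilberger certificate for `a`. -/
noncomputable def B (n k : ℕ) : ℝ :=
  4 * (2 * (n : ℝ) + 3) * ((k : ℝ) * (2 * k + 1) - (2 * (n : ℝ) + 3) ^ 2) * t (n + 1) k ^ 2

lemma a_step {n k : ℕ} (h : k ≤ n + 1) :
    ((n : ℝ) + 2) ^ 3 * t (n + 2) (k + 1) ^ 2 - P n * t (n + 1) (k + 1) ^ 2 +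
      ((n : ℝ) + 1) ^ 3 * t n (k + 1) ^ 2 = B n (k + 1) - B n k := by
  obtain ⟨g, hg, h1, h2, h3, h4⟩ := t_param h
  unfold B P
  rw [h1, h2, h3, h4]
  push_cast
  ring

/-- Apéry's denominators. -/
noncomputable def a (n : ℕ) : ℝ := ∑ k ∈ Finset.range (n + 1), t n k ^ 2

lemma a_eq {n N : ℕ} (h : n + 1 ≤ N) : a n = ∑ k ∈ Finset.range N, t n k ^ 2 := by
  unfold a
  apply Finset.sum_subset
  · intro x hx
    simp only [Finset.mem_range] at *
    omega
  · intro x _ hx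
    rw [t_eq_zero]
    · simp
    · simpa using hx

lemma a_rec (n : ℕ) :
    ((n : ℝ) + 2) ^ 3 * a (n + 2) - P n * a (n + 1) + ((n : ℝ) + 1) ^ 3 * a n = 0 := by
  rw [a_eq (show n + 2 + 1 ≤ n + 3 by omega), a_eq (show n + 1 + 1 ≤ n + 3 by omega),
    a_eq (show n + 1 ≤ n + 3 by omega), Finset.mul_sum, Finset.mul_sum, Finset.mul_sum,
    ← Finset.sum_sub_distrib, ← Finset.sum_add_distrib]
  have key : ∀ K ≤ n + 2, ∑ k ∈ Finset.range (K + 1), (((n : ℝ) + 2) ^ 3 * t (n + 2) k ^ 2 -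
      P n * t (n + 1) k ^ 2 + ((n : ℝ) + 1) ^ 3 * t n k ^ 2) = B n K := by
    intro K
    induction K with
    | zero =>
      intro _
      simp only [zero_add, Finset.sum_range_one, t_zero_right, B, P]
      push_cast
      ring
    | succ K ih =>
      intro hK
      rw [Finset.sum_range_succ, ih (by omega), a_step (by omega)]
      ring
  rw [key (n + 2) le_rfl]
  simp [B, t_eq_zero (show n + 1 < n + 2 by omega)]

/-- The auxiliary double sequence converging to `ζ(3)`. -/
noncomputable def c (n k : ℕ) : ℝ :=
  ∑ m ∈ Finset.range n, 1 / ((m : ℝ) + 1) ^ 3 +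
    ∑ m ∈ Finset.range k, (-1 : ℝ) ^ m / (2 * ((m : ℝ) + 1) ^ 3 * t n (m + 1))

lemma c_succ_right (n k : ℕ) :
    c n (k + 1) = c n k + (-1 : ℝ) ^ k / (2 * ((k : ℝ) + 1) ^ 3 * t n (k + 1)) := by
  simp only [c, Finset.sum_range_succ]
  ring

lemma c_succ_left {n k : ℕ} (h : k ≤ n) :
    c (n + 1) k = c n k + (-1 : ℝ) ^ k / (((n : ℝ) + 1) ^ 2 * (n + 1 + k) * t n k) := by
  induction k with
  | zero =>
    simp only [c, Finset.sum_range_succ, Finset.sum_range_zero, t_zero_right]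
    push_cast
    have : (n : ℝ) + 1 ≠ 0 := by positivity
    field_simp
    ring
  | succ k ih =>
    have hx := t_pos (show k ≤ n by omega)
    rw [c_succ_right, c_succ_right, ih (by omega)]
    have hk : (k : ℝ) + 1 ≠ 0 := by positivity
    have e1 : t n (k + 1) = t n k * ((n : ℝ) - k) * (n + k + 1) / ((k : ℝ) + 1) ^ 2 := by
      rw [eq_div_iff (by positivity)]
      exact t_rel2 (by omega)
    have e2 : t (n + 1) (k + 1) = t n k * ((n : ℝ) + k + 1) * (n + k + 2) / ((k : ℝ) + 1) ^ 2 := by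
      rw [eq_div_iff (by positivity)]
      exact t_rel3 n k
    have h1 : (n : ℝ) - k ≠ 0 := by
      have : (k : ℝ) + 1 ≤ n := by exact_mod_cast h
      intro h0
      linarith
    have h2 : (n : ℝ) + k + 1 ≠ 0 := by positivity
    have h2' : (n : ℝ) + 1 + k ≠ 0 := by positivity
    have h3 : (n : ℝ) + k + 2 ≠ 0 := by positivity
    have h3' : (n : ℝ) + 1 + (k + 1) ≠ 0 := by positivity
    have h4 : (n : ℝ) + 1 ≠ 0 := by positivity
    rw [e1, e2, pow_succ (-1 : ℝ) k]
    generalize (-1 : ℝ) ^ k = s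
    have hx' := hx.ne'
    generalize t n k = x at *
    push_cast
    field_simp
    ring

/-- Zeilberger certificate for `b`. -/
noncomputable def A (n k : ℕ) : ℝ :=
  B n k * c (n + 1) k - 5 * (2 * (n : ℝ) + 3) * (-1) ^ k * k / (((n : ℝ) + 1) * (n + 2)) * t (n + 1) k

lemma b_step {n k : ℕ} (h : k ≤ n + 1) :
    ((n : ℝ) + 2) ^ 3 * (t (n + 2) (k + 1) ^ 2 * c (n + 2) (k + 1)) -
      P n * (t (n + 1) (k + 1) ^ 2 * c (n + 1) (k + 1)) +
      ((n : ℝ) + 1) ^ 3 * (t n (k + 1) ^ 2 * c n (k + 1)) = A n (k + 1) - A n k := by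
  obtain ⟨g, hg, h1, h2, h3, h4⟩ := t_param h
  have hg' := hg.ne'
  have hk : (k : ℝ) + 1 ≠ 0 := by positivity
  have p1 : (n : ℝ) + 1 ≠ 0 := by positivity
  have p2 : (n : ℝ) + 2 ≠ 0 := by positivity
  have p3 : (n : ℝ) + k + 2 ≠ 0 := by positivity
  have p4 : (n : ℝ) + k + 3 ≠ 0 := by positivity
  rcases Nat.lt_or_ge n k with h' | h'
  · obtain rfl : k = n + 1 := by omega
    have ea : t n (n + 1 + 1) = 0 := t_eq_zero (by omega)
    have eb : t (n + 1) (n + 1 + 1) = 0 := t_eq_zero (by omega)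
    have ec := c_succ_right (n + 2) (n + 1)
    have ed := @c_succ_left (n + 1) (n + 1) le_rfl
    rw [show n + 1 + 1 = n + 2 by omega] at ed
    rw [ed, h3, h1] at ec
    unfold A B
    rw [ea, eb, ec, h3, h1]
    generalize c (n + 1) (n + 1) = C
    rw [pow_succ (-1 : ℝ) (n + 1), pow_succ (-1 : ℝ) n]
    generalize (-1 : ℝ) ^ n = s
    push_cast at *
    have p5 : (n : ℝ) + (n + 1) + 2 ≠ 0 := by positivity
    have p6 : (n : ℝ) + (n + 1) + 3 ≠ 0 := by positivity
    have p7 : (n : ℝ) + 1 + 1 ≠ 0 := by positivity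
    have p8 : (n : ℝ) + 1 + 1 + (n + 1) ≠ 0 := by positivity
    field_simp
    ring
  · have q1 : (n : ℝ) + 1 - k ≠ 0 := by
      have : (k : ℝ) ≤ n := by exact_mod_cast h'
      intro h0
      linarith
    have ec := @c_succ_left (n + 1) (k + 1) (by omega)
    rw [show n + 1 + 1 = n + 2 by omega] at ec
    have ed := c_succ_right (n + 1) k
    -- the lower neighbour
    have ef : t n (k + 1) ^ 2 * c n (k + 1) = t n (k + 1) ^ 2 * c (n + 1) (k + 1) -
        t n (k + 1) * (-1 : ℝ) ^ (k + 1) / (((n : ℝ) + 1) ^ 2 * (n + k + 2)) := by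
      rcases Nat.lt_or_ge n (k + 1) with h6 | h6
      · rw [t_eq_zero h6]
        simp
      · have := t_pos h6
        have h7 := this.ne'
        rw [c_succ_left h6]
        push_cast
        have p8 : (n : ℝ) + 1 + (k + 1) ≠ 0 := by positivity
        field_simp
        ring
    rw [ef, ec, ed]
    unfold A B P
    rw [ed, h1, h2, h3, h4]
    generalize c (n + 1) k = C
    rw [pow_succ (-1 : ℝ) k]
    generalize (-1 : ℝ) ^ k = s
    push_cast
    have p7 : (n : ℝ) + 1 + 1 ≠ 0 := by positivity
    have p8 : (n : ℝ) + 1 + 1 + (k + 1) ≠ 0 := by positivity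
    field_simp
    ring

/-- Apéry's numerators. -/
noncomputable def b (n : ℕ) : ℝ := ∑ k ∈ Finset.range (n + 1), t n k ^ 2 * c n k

lemma b_eq {n N : ℕ} (h : n + 1 ≤ N) : b n = ∑ k ∈ Finset.range N, t n k ^ 2 * c n k := by
  unfold b
  apply Finset.sum_subset
  · intro x hx
    simp only [Finset.mem_range] at *
    omega
  · intro x _ hx
    rw [t_eq_zero]
    · simp
    · simpa using hx

lemma b_rec (n : ℕ) :
    ((n : ℝ) + 2) ^ 3 * b (n + 2) - P n * b (n + 1) + ((n : ℝ) + 1) ^ 3 * b n = 0 := by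
  rw [b_eq (show n + 2 + 1 ≤ n + 3 by omega), b_eq (show n + 1 + 1 ≤ n + 3 by omega),
    b_eq (show n + 1 ≤ n + 3 by omega), Finset.mul_sum, Finset.mul_sum, Finset.mul_sum,
    ← Finset.sum_sub_distrib, ← Finset.sum_add_distrib]
  have key : ∀ K ≤ n + 2, ∑ k ∈ Finset.range (K + 1), (((n : ℝ) + 2) ^ 3 * (t (n + 2) k ^ 2 * c (n + 2) k) -
      P n * (t (n + 1) k ^ 2 * c (n + 1) k) + ((n : ℝ) + 1) ^ 3 * (t n k ^ 2 * c n k)) = A n K := by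
    intro K
    induction K with
    | zero =>
      intro _
      have e1 := @c_succ_left (n + 1) 0 (by omega)
      have e2 := @c_succ_left n 0 (by omega)
      rw [show n + 1 + 1 = n + 2 by omega, e2] at e1
      simp only [zero_add, Finset.sum_range_one, e1, t_zero_right, A, B, P, e2]
      have p1 : (n : ℝ) + 1 ≠ 0 := by positivity
      have p2 : (n : ℝ) + 2 ≠ 0 := by positivity
      have p3 : (n : ℝ) + 1 + 1 ≠ 0 := by positivity
      push_cast
      field_simp
      ring
    | succ K ih =>
      intro hK
      rw [Finset.sum_range_succ, ih (by omega), b_step (by omega)]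
      ring
  rw [key (n + 2) le_rfl]
  simp [A, B, t_eq_zero (show n + 1 < n + 2 by omega)]

lemma casoratian (n : ℕ) : a n * b (n + 1) - a (n + 1) * b n = 6 / ((n : ℝ) + 1) ^ 3 := by
  induction n with
  | zero =>
    norm_num [a, b, c, t, Finset.sum_range_succ]
  | succ n ih =>
    have h1 := a_rec n
    have h2 := b_rec n
    have p1 : (n : ℝ) + 1 ≠ 0 := by positivity
    have p2 : (n : ℝ) + 2 ≠ 0 := by positivity
    rw [eq_div_iff (by positivity)] at ih
    push_cast
    rw [show (n : ℝ) + 1 + 1 = n + 2 by ring, eq_div_iff (by positivity)]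
    rw [show n + 1 + 1 = n + 2 by omega]
    linear_combination ih + a (n + 1) * h2 - b (n + 1) * h1

end Apery

namespace Apery
section lcm
open Chebyshev Nat

lemma lcmUpto_dvd_aux {m : ℕ} (hm : 0 < m) :
    lcmUpto (42 * m) * ((21 * m)! * (14 * m)! * (6 * m)! * m !) ∣ lcmUpto m * (42 * m)! := by
  have f0 : ∀ n : ℕ, n ! ≠ 0 := Nat.factorial_ne_zero
  have l0 := lcmUpto_ne_zero
  rw [← Nat.factorization_prime_le_iff_dvd
    (mul_ne_zero (l0 _) (mul_ne_zero (mul_ne_zero (mul_ne_zero (f0 _) (f0 _)) (f0 _)) (f0 _)))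
    (mul_ne_zero (l0 _) (f0 _))]
  intro p hp
  rw [Nat.factorization_mul (l0 _) (mul_ne_zero (mul_ne_zero (mul_ne_zero (f0 _) (f0 _)) (f0 _)) (f0 _)),
    Nat.factorization_mul (mul_ne_zero (mul_ne_zero (f0 _) (f0 _)) (f0 _)) (f0 _),
    Nat.factorization_mul (mul_ne_zero (f0 _) (f0 _)) (f0 _),
    Nat.factorization_mul (f0 _) (f0 _), Nat.factorization_mul (l0 _) (f0 _)]
  simp only [Finsupp.add_apply]
  have hlog : ∀ j ≤ 42 * m, Nat.log p j < Nat.log p (42 * m) + 1 := fun j hj =>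
    Nat.lt_succ_of_le (Nat.log_mono_right hj)
  rw [factorization_lcmUpto _ hp, factorization_lcmUpto _ hp,
    Nat.factorization_factorial hp (hlog (21 * m) (by omega)),
    Nat.factorization_factorial hp (hlog (14 * m) (by omega)),
    Nat.factorization_factorial hp (hlog (6 * m) (by omega)),
    Nat.factorization_factorial hp (hlog m (by omega)),
    Nat.factorization_factorial hp (hlog (42 * m) (by omega))]
  set b := Nat.log p (42 * m) + 1 with hb
  have e1 : Nat.log p (42 * m) = ∑ i ∈ Finset.Ico 1 b, 1 := by simp [hb]
  have e2 : ∑ i ∈ Finset.Ico 1 b, (if p ^ i ≤ m then 1 else 0) ≤ Nat.log p m := by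
    rw [← Finset.card_filter]
    calc _ ≤ (Finset.Icc 1 (Nat.log p m)).card := by
          apply Finset.card_le_card
          intro i hi
          simp only [Finset.mem_filter, Finset.mem_Ico, Finset.mem_Icc] at *
          exact ⟨hi.1.1, Nat.le_log_of_pow_le hp.one_lt hi.2⟩
      _ = _ := by simp
  rw [e1]
  refine le_trans ?_ (Nat.add_le_add_right e2 _)
  rw [← Finset.sum_add_distrib, ← Finset.sum_add_distrib, ← Finset.sum_add_distrib,
    ← Finset.sum_add_distrib, ← Finset.sum_add_distrib]
  apply Finset.sum_le_sum
  intro i hi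
  simp only [Finset.mem_Ico] at hi
  have hM : p ^ i ≤ 42 * m := by
    apply Nat.pow_le_of_le_log (by omega)
    omega
  have hM0 : 0 < p ^ i := pow_pos hp.pos i
  generalize p ^ i = M at *
  have d2 : 21 * m / M = (42 * m / M) / 2 := by
    rw [Nat.div_div_eq_div_mul, mul_comm M, ← Nat.div_div_eq_div_mul]; congr 1; omega
  have d3 : 14 * m / M = (42 * m / M) / 3 := by
    rw [Nat.div_div_eq_div_mul, mul_comm M, ← Nat.div_div_eq_div_mul]; congr 1; omega
  have d7 : 6 * m / M = (42 * m / M) / 7 := by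
    rw [Nat.div_div_eq_div_mul, mul_comm M, ← Nat.div_div_eq_div_mul]; congr 1; omega
  have d42 : m / M = (42 * m / M) / 42 := by
    rw [Nat.div_div_eq_div_mul, mul_comm M, ← Nat.div_div_eq_div_mul]; congr 1; omega
  have hQ : 1 ≤ 42 * m / M := Nat.div_pos hM hM0
  have hq1 : ¬ M ≤ m → 42 * m / M < 42 := by
    intro h
    rw [Nat.div_lt_iff_lt_mul hM0]
    omega
  rw [d2, d3, d7, d42]
  generalize 42 * m / M = Q at *
  split_ifs with h
  · omega
  · have := hq1 h
    interval_cases Q <;> simp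

/-- The base of the exponential bound. -/
def K : ℕ := 2 ^ 28 * 3 ^ 21 * 7 ^ 7

lemma choose_mul_pow_le (x n k : ℕ) (h : k ≤ n) : n.choose k * x ^ k ≤ (x + 1) ^ n := by
  rw [add_pow]
  have := Finset.single_le_sum (s := Finset.range (n + 1))
    (f := fun m => x ^ m * 1 ^ (n - m) * (n.choose m)) (fun _ _ => Nat.zero_le _)
    (Finset.mem_range.mpr (Nat.lt_succ_of_le h))
  simp only [one_pow, mul_one] at this ⊢
  linarith

lemma lcmUpto_mul_le {m : ℕ} (hm : 0 < m) :
    lcmUpto (42 * m) * 6 ^ (6 * m) ≤ lcmUpto m * K ^ m := by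
  have h1 := Nat.le_of_dvd (Nat.mul_pos (lcmUpto_pos _) (Nat.factorial_pos _)) (lcmUpto_dvd_aux hm)
  have c1 := Nat.add_choose_mul_factorial_mul_factorial (21 * m) (21 * m)
  have c2 := Nat.add_choose_mul_factorial_mul_factorial (7 * m) (14 * m)
  have c3 := Nat.add_choose_mul_factorial_mul_factorial m (6 * m)
  rw [show 21 * m + 21 * m = 42 * m by ring] at c1
  rw [show 7 * m + 14 * m = 21 * m by ring] at c2
  rw [show m + 6 * m = 7 * m by ring] at c3
  have b1 := choose_mul_pow_le 1 (42 * m) (21 * m) (by omega)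
  have b2 := choose_mul_pow_le 2 (21 * m) (14 * m) (by omega)
  have b3 := choose_mul_pow_le 6 (7 * m) (6 * m) (by omega)
  have e : (42 * m)! = ((42 * m).choose (21 * m) * (21 * m).choose (14 * m) * (7 * m).choose (6 * m)) *
      ((21 * m)! * (14 * m)! * (6 * m)! * m !) := by
    calc _ = (42 * m).choose (21 * m) * (21 * m)! * ((21 * m).choose (14 * m) *
          ((7 * m).choose (6 * m) * m ! * (6 * m)!) * (14 * m)!) := by rw [c3, c2, c1]
      _ = _ := by ring
  rw [e, ← mul_assoc (lcmUpto m)] at h1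
  have h2 := Nat.le_of_mul_le_mul_right h1 (by positivity)
  simp only [one_pow, mul_one] at b1
  have h3 : (42 * m).choose (21 * m) * ((21 * m).choose (14 * m) * 2 ^ (14 * m)) *
      ((7 * m).choose (6 * m) * 6 ^ (6 * m)) ≤ 2 ^ (42 * m) * 3 ^ (21 * m) * 7 ^ (7 * m) := by
    gcongr
  have h4 : 2 ^ (42 * m) * 3 ^ (21 * m) * 7 ^ (7 * m) = K ^ m * 2 ^ (14 * m) := by
    simp only [K, mul_pow, ← pow_mul]
    rw [show 42 * m = 28 * m + 14 * m by ring, pow_add]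
    ring
  rw [h4] at h3
  have h5 : (42 * m).choose (21 * m) * (21 * m).choose (14 * m) *
      (7 * m).choose (6 * m) * 6 ^ (6 * m) ≤ K ^ m := by
    apply Nat.le_of_mul_le_mul_right (c := 2 ^ (14 * m)) _ (by positivity)
    calc _ = _ := by ring
      _ ≤ _ := h3
  calc _ ≤ (lcmUpto m * ((42 * m).choose (21 * m) * (21 * m).choose (14 * m) *
      (7 * m).choose (6 * m))) * 6 ^ (6 * m) := by gcongr
    _ = lcmUpto m * ((42 * m).choose (21 * m) * (21 * m).choose (14 * m) *
      (7 * m).choose (6 * m) * 6 ^ (6 * m)) := by ring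
    _ ≤ _ := by gcongr

lemma lcmUpto_mono {m n : ℕ} (h : m ≤ n) : lcmUpto m ≤ lcmUpto n := by
  apply Nat.le_of_dvd (lcmUpto_pos n)
  unfold lcmUpto
  exact Finset.lcm_mono (Finset.Icc_subset_Icc_right h)

lemma lcmUpto_bound : ∃ C : ℝ, 0 < C ∧ ∀ n : ℕ, (lcmUpto n : ℝ) ≤ C * (16 / 5 : ℝ) ^ n := by
  obtain ⟨C, hC, hC2⟩ : ∃ C : ℝ, 0 < C ∧ ∀ n < 2000, (lcmUpto n : ℝ) ≤ C :=
    ⟨lcmUpto 2000, Nat.cast_pos.mpr (lcmUpto_pos _), fun n h => Nat.cast_le.mpr (lcmUpto_mono h.le)⟩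
  refine ⟨C, hC, ?_⟩
  intro n
  induction n using Nat.strong_induction_on with
  | _ n ih =>
    rcases Nat.lt_or_ge n 2000 with h | h
    · calc (lcmUpto n : ℝ) ≤ C := hC2 n h
        _ ≤ _ := le_mul_of_one_le_right hC.le (one_le_pow₀ (by norm_num))
    · obtain ⟨q, hq⟩ : ∃ q, q = n / 42 := ⟨_, rfl⟩
      have hq1 : 41 ≤ q := by omega
      have hn : n ≤ 42 * (q + 1) := by omega
      have hn' : 42 * q ≤ n := by omega
      have i1 := ih (q + 1) (by omega)
      have i2 : (lcmUpto (42 * (q + 1)) : ℝ) * (6 ^ 6) ^ (q + 1) ≤ lcmUpto (q + 1) * (K : ℝ) ^ (q + 1) := by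
        rw [← pow_mul]
        exact_mod_cast lcmUpto_mul_le (show 0 < q + 1 by omega)
      have i3 : (lcmUpto n : ℝ) ≤ lcmUpto (42 * (q + 1)) := by exact_mod_cast lcmUpto_mono hn
      have hK : (K : ℝ) * (16 / 5) ≤ 6 ^ 6 * (16 / 5) ^ 41 := by
        norm_num [K]
      have i4 : ((K : ℝ) * (16 / 5)) ^ (q + 1) ≤ (6 ^ 6 * (16 / 5) ^ 41) ^ (q + 1) := by
        gcongr
      have i5 : ((16 / 5 : ℝ) ^ 41) ^ (q + 1) ≤ (16 / 5) ^ n := by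
        rw [← pow_mul]
        exact pow_le_pow_right₀ (by norm_num) (by omega)
      have hp : (0 : ℝ) < (6 ^ 6) ^ (q + 1) := by positivity
      refine le_of_mul_le_mul_right ?_ hp
      calc (lcmUpto n : ℝ) * (6 ^ 6) ^ (q + 1) ≤ lcmUpto (42 * (q + 1)) * (6 ^ 6) ^ (q + 1) := by gcongr
        _ ≤ lcmUpto (q + 1) * (K : ℝ) ^ (q + 1) := i2
        _ ≤ (C * (16 / 5 : ℝ) ^ (q + 1)) * (K : ℝ) ^ (q + 1) := by gcongr
        _ = C * ((K : ℝ) * (16 / 5)) ^ (q + 1) := by rw [mul_pow]; ring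
        _ ≤ C * (6 ^ 6 * (16 / 5) ^ 41) ^ (q + 1) := by gcongr
        _ = C * ((16 / 5) ^ 41) ^ (q + 1) * (6 ^ 6) ^ (q + 1) := by
          rw [mul_pow (6 ^ 6 : ℝ)]; ring
        _ ≤ _ := by gcongr

/-- The ring of integers inside the reals. -/
noncomputable def Z : Subring ℝ := (Int.castRingHom ℝ).range

lemma nat_mem (n : ℕ) : (n : ℝ) ∈ Z := ⟨n, by simp⟩

lemma lcm_div_mem {N m : ℕ} (h1 : 1 ≤ m) (h2 : m ≤ N) : (lcmUpto N : ℝ) / m ∈ Z := by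
  have : m ∣ lcmUpto N := Finset.dvd_lcm (f := id) (Finset.mem_Icc.mpr ⟨h1, h2⟩)
  obtain ⟨r, hr⟩ := this
  rw [hr]
  have hm : (m : ℝ) ≠ 0 := by positivity
  push_cast
  rw [mul_div_cancel_left₀ _ hm]
  exact nat_mem r

lemma lcm_div_choose_mem {N : ℕ} (m : ℕ) : ∀ n, m + 1 ≤ n → n ≤ N →
    (lcmUpto N : ℝ) / (((m : ℝ) + 1) * n.choose (m + 1)) ∈ Z := by
  induction m with
  | zero =>
    intro n h1 h2
    have := lcm_div_mem h1 h2
    simpa using this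
  | succ m ih =>
    intro n h1 h2
    obtain ⟨n, rfl⟩ : ∃ n', n = n' + 1 := ⟨n - 1, by omega⟩
    have i1 := ih n (by omega) (by omega)
    have i2 := ih (n + 1) (by omega) (by omega)
    have e1 : ((n : ℝ) + 1) * (n.choose (m + 1) : ℝ) = ((n + 1).choose (m + 2) : ℝ) * (m + 1 + 1) := by
      exact_mod_cast Nat.add_one_mul_choose_eq n (m + 1)
    have e2 : ((n : ℝ) + 1) * (n.choose m : ℝ) = ((n + 1).choose (m + 1) : ℝ) * (m + 1) := by
      exact_mod_cast Nat.add_one_mul_choose_eq n m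
    have e3 : (n.choose (m + 1) : ℝ) * (m + 1) = (n.choose m : ℝ) * ((n : ℝ) - m) := by
      have := congrArg (Nat.cast : ℕ → ℝ) (Nat.choose_succ_right_eq n m)
      push_cast [Nat.cast_sub (show m ≤ n by omega)] at this
      exact this
    have hY : (0 : ℝ) < n.choose m := by exact_mod_cast Nat.choose_pos (by omega)
    have hnm : (0 : ℝ) < (n : ℝ) - m := by
      have : (m : ℝ) + 2 ≤ n + 1 := by exact_mod_cast h1
      linarith
    have key : (lcmUpto N : ℝ) / ((((m + 1 : ℕ) : ℝ) + 1) * (n + 1).choose (m + 1 + 1)) =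
        (lcmUpto N : ℝ) / (((m : ℝ) + 1) * n.choose (m + 1)) -
        (lcmUpto N : ℝ) / (((m : ℝ) + 1) * (n + 1).choose (m + 1)) := by
      have hm : (m : ℝ) + 1 ≠ 0 := by positivity
      have e3' : (n.choose (m + 1) : ℝ) = (n.choose m : ℝ) * ((n : ℝ) - m) / (m + 1) := by
        field_simp
        linarith
      rw [show (((m + 1 : ℕ) : ℝ) + 1) * ((n + 1).choose (m + 1 + 1) : ℝ) =
        ((n : ℝ) + 1) * (n.choose (m + 1) : ℝ) by rw [e1]; push_cast; ring,
        show ((m : ℝ) + 1) * ((n + 1).choose (m + 1) : ℝ) = ((n : ℝ) + 1) * (n.choose m : ℝ) by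
          rw [e2]; ring, e3']
      have hn : (n : ℝ) + 1 ≠ 0 := by positivity
      have := hY.ne'
      have := hnm.ne'
      field_simp
      ring
    rw [key]
    exact Z.sub_mem i1 i2

end lcm
end Apery

namespace Apery
open Nat (lcmUpto lcmUpto_pos)

lemma t_mem (n k : ℕ) : t n k ∈ Z := Z.mul_mem (nat_mem _) (nat_mem _)

lemma a_mem (n : ℕ) : a n ∈ Z := Z.sum_mem fun k _ => Z.pow_mem (t_mem n k) 2

lemma t_div {n k m : ℕ} (hk : k ≤ n) (hm : m ≤ k) :
    t n k / t n m = n.choose k * (n + k).choose (n + m) / (n.choose m * k.choose m) := by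
  have h := @Nat.choose_mul (n + k) (n + m) n (by omega)
  rw [show n + k - n = k by omega, show n + m - n = m by omega, Nat.choose_symm_add,
    Nat.choose_symm_add] at h
  have h' : ((n + k).choose (n + m) : ℝ) * (n + m).choose m = (n + k).choose k * k.choose m := by
    exact_mod_cast h
  have p1 : (0 : ℝ) < n.choose m := by exact_mod_cast Nat.choose_pos (by omega)
  have p2 : (0 : ℝ) < k.choose m := by exact_mod_cast Nat.choose_pos (by omega)
  have p3 : (0 : ℝ) < (n + m).choose m := by exact_mod_cast Nat.choose_pos (by omega)
  unfold t
  rw [div_eq_div_iff (by positivity) (by positivity)]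
  linear_combination (-(n.choose k : ℝ) * n.choose m) * h'

lemma b_mem (n : ℕ) : 2 * (lcmUpto n : ℝ) ^ 3 * b n ∈ Z := by
  unfold b
  rw [Finset.mul_sum]
  refine Z.sum_mem fun k hk => ?_
  have hk' : k ≤ n := by
    simp only [Finset.mem_range] at hk
    omega
  unfold c
  rw [mul_add, mul_add, Finset.mul_sum, Finset.mul_sum, Finset.mul_sum, Finset.mul_sum]
  refine Z.add_mem (Z.sum_mem fun m hm => ?_) (Z.sum_mem fun m hm => ?_)
  · simp only [Finset.mem_range] at hm
    have h1 := @lcm_div_mem n (m + 1) (by omega) (by omega)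
    push_cast at h1
    have : 2 * (lcmUpto n : ℝ) ^ 3 * (t n k ^ 2 * (1 / ((m : ℝ) + 1) ^ 3)) =
        ((2 : ℕ) : ℝ) * t n k ^ 2 * ((lcmUpto n : ℝ) / (m + 1)) ^ 3 := by
      push_cast
      rw [div_pow]
      ring
    rw [this]
    exact Z.mul_mem (Z.mul_mem (nat_mem 2) (Z.pow_mem (t_mem n k) 2)) (Z.pow_mem h1 3)
  · simp only [Finset.mem_range] at hm
    have h1 := @lcm_div_mem n (m + 1) (by omega) (by omega)
    push_cast at h1
    have h2 := lcm_div_choose_mem (N := n) m n (by omega) le_rfl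
    have h3 := lcm_div_choose_mem (N := n) m k (by omega) hk'
    have ht := @t_div n k (m + 1) hk' (by omega)
    have p0 := (t_pos (show m + 1 ≤ n by omega)).ne'
    have p1 : (n.choose (m + 1) : ℝ) ≠ 0 := by
      exact_mod_cast (Nat.choose_pos (show m + 1 ≤ n by omega)).ne'
    have p2 : (k.choose (m + 1) : ℝ) ≠ 0 := by
      exact_mod_cast (Nat.choose_pos (show m + 1 ≤ k by omega)).ne'
    have p3 : (m : ℝ) + 1 ≠ 0 := by positivity
    have : 2 * (lcmUpto n : ℝ) ^ 3 * (t n k ^ 2 * ((-1) ^ m / (2 * ((m : ℝ) + 1) ^ 3 * t n (m + 1)))) =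
        (-1) ^ m * t n k * n.choose k * (n + k).choose (n + (m + 1)) *
        (((lcmUpto n : ℝ) / (m + 1)) * ((lcmUpto n : ℝ) / (((m : ℝ) + 1) * n.choose (m + 1))) *
        ((lcmUpto n : ℝ) / (((m : ℝ) + 1) * k.choose (m + 1)))) := by
      calc _ = (lcmUpto n : ℝ) ^ 3 * (-1) ^ m * t n k * (t n k / t n (m + 1)) / ((m : ℝ) + 1) ^ 3 := by
            field_simp
        _ = _ := by
            rw [ht]
            field_simp
    rw [this]
    exact Z.mul_mem (Z.mul_mem (Z.mul_mem (Z.mul_mem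
      (Z.pow_mem (Z.neg_mem Z.one_mem) m) (t_mem n k)) (nat_mem _)) (nat_mem _))
      (Z.mul_mem (Z.mul_mem h1 h2) h3)

lemma t_nonneg (n k : ℕ) : 0 ≤ t n k := by
  unfold t
  positivity

lemma t_mono (n k : ℕ) : t n k ≤ t (n + 1) k := by
  have h1 : n.choose k ≤ (n + 1).choose k := Nat.choose_le_choose k (by omega)
  have h2 : (n + k).choose k ≤ (n + 1 + k).choose k := Nat.choose_le_choose k (by omega)
  unfold t
  gcongr

lemma a_mono (n : ℕ) : a n ≤ a (n + 1) := by
  rw [a_eq (show n + 1 ≤ n + 2 by omega)]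
  refine Finset.sum_le_sum fun k _ => ?_
  exact pow_le_pow_left₀ (t_nonneg n k) (t_mono n k) 2

lemma a_pos (n : ℕ) : 0 < a n := by
  have : ∀ m, a 0 ≤ a m := fun m => monotone_nat_of_le_succ a_mono (Nat.zero_le m)
  have h0 : a 0 = 1 := by simp [a, t]
  linarith [this n]

lemma a_growth {n : ℕ} (h : 1001 ≤ n) : (329 / 10 : ℝ) * a n ≤ a (n + 1) := by
  obtain ⟨n, rfl⟩ : ∃ n', n = n' + 1 := ⟨n - 1, by omega⟩
  have h1 := a_rec n
  have h2 := a_mono n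
  have h3 := a_pos (n + 1)
  have hn : (1000 : ℝ) ≤ n := by
    have : 1000 ≤ n := by omega
    exact_mod_cast this
  rw [show n + 1 + 1 = n + 2 by omega]
  have p : (0 : ℝ) < ((n : ℝ) + 2) ^ 3 := by positivity
  refine le_of_mul_le_mul_left ?_ p
  have h4 : (329 / 10 : ℝ) * ((n : ℝ) + 2) ^ 3 ≤ P n - ((n : ℝ) + 1) ^ 3 := by
    unfold P
    clear h h1 h2 h3 p
    generalize (n : ℝ) = x at *
    obtain ⟨y, rfl⟩ : ∃ y, x = y + 1000 := ⟨x - 1000, by ring⟩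
    have hy : 0 ≤ y := by linarith
    have h2 : 0 ≤ y ^ 2 := by positivity
    have h3 : 0 ≤ y ^ 3 := by positivity
    ring_nf
    linarith
  have h5 := mul_le_mul_of_nonneg_right h4 h3.le
  have h6 : ((n : ℝ) + 1) ^ 3 * a n ≤ ((n : ℝ) + 1) ^ 3 * a (n + 1) := by gcongr
  clear h hn h2 h3 p h4
  linarith

lemma a_lower_aux {N : ℕ} (hN : ∀ n ≥ N, (329 / 10 : ℝ) * a n ≤ a (n + 1)) :
    ∃ e : ℝ, 0 < e ∧ ∀ n ≥ N, e * (329 / 10 : ℝ) ^ n ≤ a n := by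
  refine ⟨a N / (329 / 10 : ℝ) ^ N, div_pos (a_pos _) (pow_pos (by norm_num) _), ?_⟩
  intro n hn
  induction n, hn using Nat.le_induction with
  | base => rw [div_mul_cancel₀ _ (pow_ne_zero _ (by norm_num))]
  | succ n hn ih =>
    have := hN n hn
    rw [pow_succ, ← mul_assoc]
    linarith

lemma a_lower : ∃ e : ℝ, 0 < e ∧ ∀ n ≥ 1001, e * (329 / 10 : ℝ) ^ n ≤ a n :=
  a_lower_aux fun _ h => a_growth h

lemma summable_zeta3 : Summable fun n : ℕ => 1 / ((n : ℝ) + 1) ^ 3 := by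
  have h := (summable_nat_add_iff 1).mpr (Real.summable_one_div_nat_pow.mpr (show 1 < 3 by norm_num))
  simpa using h

lemma partial_le (k : ℕ) : ∑ m ∈ Finset.range k, 1 / ((m : ℝ) + 1) ^ 3 ≤ zeta3 :=
  summable_zeta3.sum_le_tsum _ fun _ _ => by positivity

lemma t_ge {n m : ℕ} (h : m + 1 ≤ n) : (n : ℝ) + 1 ≤ t n (m + 1) := by
  have h1 : 1 ≤ n.choose (m + 1) := Nat.choose_pos h
  have h2 : n + 1 ≤ (n + (m + 1)).choose (m + 1) := by
    rw [← Nat.choose_symm_add]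
    calc n + 1 = (n + 1).choose n := by simp
      _ ≤ _ := Nat.choose_le_choose n (by omega)
  have h1' : (1 : ℝ) ≤ n.choose (m + 1) := by exact_mod_cast h1
  have h2' : (n : ℝ) + 1 ≤ (n + (m + 1)).choose (m + 1) := by exact_mod_cast h2
  unfold t
  nlinarith

lemma c_close {n k : ℕ} (h : k ≤ n) :
    |c n k - ∑ m ∈ Finset.range n, 1 / ((m : ℝ) + 1) ^ 3| ≤ zeta3 / (n + 1) := by
  unfold c
  rw [add_sub_cancel_left]
  calc _ ≤ ∑ m ∈ Finset.range k, |(-1 : ℝ) ^ m / (2 * ((m : ℝ) + 1) ^ 3 * t n (m + 1))| :=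
        Finset.abs_sum_le_sum_abs _ _
    _ ≤ ∑ m ∈ Finset.range k, (1 / ((m : ℝ) + 1) ^ 3) / (n + 1) := by
        refine Finset.sum_le_sum fun m hm => ?_
        simp only [Finset.mem_range] at hm
        have ht := t_ge (show m + 1 ≤ n by omega)
        have hp := t_pos (show m + 1 ≤ n by omega)
        rw [abs_div, abs_pow, abs_neg, abs_one, one_pow, div_div, abs_of_pos (by positivity)]
        apply one_div_le_one_div_of_le (by positivity)
        have : (0 : ℝ) < ((m : ℝ) + 1) ^ 3 := by positivity
        nlinarith [mul_le_mul_of_nonneg_left ht this.le, mul_pos this hp]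
    _ = (∑ m ∈ Finset.range k, 1 / ((m : ℝ) + 1) ^ 3) / (n + 1) := by rw [Finset.sum_div]
    _ ≤ _ := by
        have := partial_le k
        gcongr

lemma x_close (n : ℕ) :
    |b n / a n - ∑ m ∈ Finset.range n, 1 / ((m : ℝ) + 1) ^ 3| ≤ zeta3 / (n + 1) := by
  have ha := a_pos n
  set H := ∑ m ∈ Finset.range n, 1 / ((m : ℝ) + 1) ^ 3 with hH
  have e : b n / a n - H = (∑ k ∈ Finset.range (n + 1), t n k ^ 2 * (c n k - H)) / a n := by
    rw [eq_div_iff ha.ne', sub_mul, div_mul_cancel₀ _ ha.ne']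
    simp only [mul_sub, Finset.sum_sub_distrib]
    rw [← Finset.sum_mul]
    unfold a b
    ring
  rw [e, abs_div, abs_of_pos ha, div_le_iff₀ ha]
  calc _ ≤ ∑ k ∈ Finset.range (n + 1), |t n k ^ 2 * (c n k - H)| := Finset.abs_sum_le_sum_abs _ _
    _ ≤ ∑ k ∈ Finset.range (n + 1), t n k ^ 2 * (zeta3 / (n + 1)) := by
        refine Finset.sum_le_sum fun k hk => ?_
        simp only [Finset.mem_range] at hk
        rw [abs_mul, abs_of_nonneg (sq_nonneg (t n k))]
        exact mul_le_mul_of_nonneg_left (c_close (by omega)) (sq_nonneg _)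
    _ = _ := by
        rw [← Finset.sum_mul, mul_comm]
        rfl

open Filter Topology

lemma x_tendsto : Tendsto (fun n => b n / a n) atTop (𝓝 zeta3) := by
  have h1 : Tendsto (fun n : ℕ => ∑ m ∈ Finset.range n, 1 / ((m : ℝ) + 1) ^ 3) atTop (𝓝 zeta3) :=
    summable_zeta3.hasSum.tendsto_sum_nat
  have h2 : Tendsto (fun n : ℕ => zeta3 / ((n : ℝ) + 1)) atTop (𝓝 0) :=
    tendsto_const_nhds.div_atTop (tendsto_atTop_add_const_right _ _ tendsto_natCast_atTop_atTop)
  have h3 := squeeze_zero_norm (fun n => by rw [Real.norm_eq_abs]; exact x_close n) h2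
  simpa using h3.add h1

lemma x_step (n : ℕ) :
    b (n + 1) / a (n + 1) - b n / a n = 6 / (((n : ℝ) + 1) ^ 3 * (a n * a (n + 1))) := by
  have h := casoratian n
  have h1 := (a_pos n).ne'
  have h2 := (a_pos (n + 1)).ne'
  have h3 : (n : ℝ) + 1 ≠ 0 := by positivity
  rw [← div_div, ← h]
  field_simp

lemma x_lt (n : ℕ) : b n / a n < zeta3 := by
  have hs : StrictMono fun n => b n / a n := by
    apply strictMono_nat_of_lt_succ
    intro n
    have := x_step n
    have h1 := a_pos n
    have h2 := a_pos (n + 1)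
    have : 0 < 6 / (((n : ℝ) + 1) ^ 3 * (a n * a (n + 1))) := by positivity
    linarith
  exact lt_of_lt_of_le (hs (Nat.lt_succ_self n)) (hs.monotone.ge_of_tendsto x_tendsto (n + 1))

lemma zeta3_le {n : ℕ} (hn : 1001 ≤ n) : zeta3 ≤ b n / a n + 1 / a n ^ 2 := by
  have step : ∀ m ≥ n, b m / a m + 1 / a m ^ 2 ≤ b n / a n + 1 / a n ^ 2 := by
    intro m hm
    induction m, hm using Nat.le_induction with
    | base => exact le_rfl
    | succ m hm ih =>
      refine le_trans ?_ ih
      have h0 := x_step m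
      have h1 := a_pos m
      have h2 := a_pos (m + 1)
      have h3 := a_growth (hn.trans hm)
      have h4 : 6 / (((m : ℝ) + 1) ^ 3 * (a m * a (m + 1))) ≤ 6 / (a m * a (m + 1)) := by
        apply div_le_div_of_nonneg_left (by norm_num) (by positivity)
        apply le_mul_of_one_le_left (by positivity)
        apply one_le_pow₀
        have : (0 : ℝ) ≤ m := by positivity
        linarith
      have h5 : 6 / (a m * a (m + 1)) + 1 / a (m + 1) ^ 2 ≤ 1 / a m ^ 2 := by
        rw [div_add_div _ _ (by positivity) (by positivity), div_le_div_iff₀ (by positivity) (by positivity)]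
        have h6 : 6 * a (m + 1) * a m + a m ^ 2 ≤ a (m + 1) ^ 2 := by nlinarith
        have h7 : 0 ≤ a m ^ 2 * a (m + 1) * 1 := by positivity
        have := mul_le_mul_of_nonneg_left h6 (show 0 ≤ a m * a (m + 1) by positivity)
        nlinarith
      linarith
  refine le_of_tendsto x_tendsto ?_
  filter_upwards [eventually_ge_atTop n] with m hm
  have := step m hm
  have h1 := a_pos m
  have : 0 < 1 / a m ^ 2 := by positivity
  linarith

lemma one_le_of_mem {x : ℝ} (hx : x ∈ Z) (h : 0 < x) : 1 ≤ x := by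
  obtain ⟨z, rfl⟩ := hx
  simp only [eq_intCast] at *
  exact_mod_cast h

end Apery

open Apery Filter Topology
open Nat (lcmUpto lcmUpto_pos)

theorem stmt_8 : Irrational zeta3 := by
  rintro ⟨r, hr⟩
  obtain ⟨C, hC, hd⟩ := lcmUpto_bound
  obtain ⟨e, he, ha⟩ := a_lower
  have hq : (0 : ℝ) < r.den := by exact_mod_cast r.den_pos
  have hz : (r.den : ℝ) * zeta3 ∈ Z := by
    refine ⟨r.num, ?_⟩
    rw [← hr]
    simp only [eq_intCast]
    have := Rat.den_mul_eq_num r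
    exact_mod_cast this.symm
  have lower : ∀ n ≥ 1001, 1 ≤ 2 * (r.den : ℝ) * C ^ 3 / e * ((32768 / 1000) / (329 / 10) : ℝ) ^ n := by
    intro n hn
    have hap := a_pos n
    have hdp : (0 : ℝ) < lcmUpto n := by exact_mod_cast lcmUpto_pos n
    have h1 := x_lt n
    have h2 := zeta3_le hn
    rw [div_lt_iff₀ hap] at h1
    have h3 : zeta3 * a n - b n ≤ 1 / a n := by
      have := mul_le_mul_of_nonneg_right h2 hap.le
      rw [add_mul, div_mul_cancel₀ _ hap.ne'] at this
      have e1 : 1 / a n ^ 2 * a n = 1 / a n := by field_simp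
      linarith
    have hmem : 2 * (r.den : ℝ) * (lcmUpto n : ℝ) ^ 3 * (zeta3 * a n - b n) ∈ Z := by
      have : 2 * (r.den : ℝ) * (lcmUpto n : ℝ) ^ 3 * (zeta3 * a n - b n) =
          ((2 * lcmUpto n ^ 3 : ℕ) : ℝ) * a n * (r.den * zeta3) -
          (r.den : ℝ) * (2 * (lcmUpto n : ℝ) ^ 3 * b n) := by
        push_cast
        ring
      rw [this]
      exact Z.sub_mem (Z.mul_mem (Z.mul_mem (nat_mem _) (a_mem n)) hz)
        (Z.mul_mem (nat_mem _) (b_mem n))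
    have hpos : 0 < 2 * (r.den : ℝ) * (lcmUpto n : ℝ) ^ 3 * (zeta3 * a n - b n) := by
      have : 0 < zeta3 * a n - b n := by linarith
      positivity
    calc (1 : ℝ) ≤ _ := one_le_of_mem hmem hpos
      _ ≤ 2 * (r.den : ℝ) * (lcmUpto n : ℝ) ^ 3 * (1 / a n) := by gcongr
      _ ≤ 2 * (r.den : ℝ) * (C * (16 / 5 : ℝ) ^ n) ^ 3 * (1 / (e * (329 / 10 : ℝ) ^ n)) := by
          have h5 := hd n
          have h6 := ha n hn
          have h7 : 0 < e * (329 / 10 : ℝ) ^ n := by positivity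
          gcongr
      _ = _ := by
          rw [mul_pow C, ← pow_mul, mul_comm n 3, pow_mul]
          have : ((16 / 5 : ℝ) ^ 3) = 32768 / 1000 := by norm_num
          rw [this, div_pow (32768 / 1000 : ℝ)]
          field_simp
  have lim : Tendsto (fun n : ℕ => 2 * (r.den : ℝ) * C ^ 3 / e *
      ((32768 / 1000) / (329 / 10) : ℝ) ^ n) atTop (𝓝 0) := by
    have := (tendsto_pow_atTop_nhds_zero_of_lt_one (r := ((32768 / 1000) / (329 / 10) : ℝ))
      (by norm_num) (by norm_num)).const_mul (2 * (r.den : ℝ) * C ^ 3 / e)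
    simpa using this
  have : (1 : ℝ) ≤ 0 := by
    refine ge_of_tendsto lim ?_
    filter_upwards [eventually_ge_atTop 1001] with n hn
    exact lower n hn
  linarith
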